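/- Let φ : {0,1,…,d} → [0,+∞] satisfy φ(0) = 0, φ(l) > 0 for all l ∈ {1,…,d}, φ(l₀) < +∞ for at least one l₀ ∈ {1,…,d}, and suppose φ is nondecreasing on {1,…,d}. Then φ(1) < +∞ and the norm φ(1)·‖·‖₁ is the tightest norm below φ∘ℓ0 on the unit ball B₁ of the ℓ1-norm: (i) for every x with ‖x‖₁ ≤ 1, φ(1)·‖x‖₁ ≤ φ(ℓ0(x)) (as elements of [0,+∞]); and (ii) every norm N on ℝ^d with N(x) ≤ φ(ℓ0(x)) for all x ∈ B₁ satisfies N(x) ≤ φ(1)·‖x‖₁ for all x ∈ ℝ^d. -/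

import Mathlib

open scoped Classical ENNReal

/-- The ℓ0 pseudonorm: number of nonzero components. -/
noncomputable def l0 {d : ℕ} (x : EuclideanSpace ℝ (Fin d)) : ℕ :=
  (Finset.univ.filter fun i => x i ≠ 0).card

theorem l0_le {d : ℕ} (x : EuclideanSpace ℝ (Fin d)) : l0 x ≤ d := by
  simpa [l0] using Finset.card_filter_le Finset.univ fun i => x i ≠ 0

theorem l0_eq_zero_iff {d : ℕ} (x : EuclideanSpace ℝ (Fin d)) : l0 x = 0 ↔ ∀ i, x i = 0 := by
  simp [l0, Finset.filter_eq_empty_iff]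

theorem l0_single {d : ℕ} (i : Fin d) : l0 (EuclideanSpace.single i (1 : ℝ)) = 1 := by
  rw [l0, Finset.card_eq_one]
  refine ⟨i, ?_⟩
  ext j
  simp

theorem sum_abs_single {d : ℕ} (i : Fin d) :
    ∑ j, |EuclideanSpace.single i (1 : ℝ) j| = 1 := by
  rw [Finset.sum_eq_single i] <;> simp +contextual

/-- A function that is subadditive and absolutely homogeneous is bounded by a multiple of the
ℓ1-norm as soon as it is bounded on the canonical basis. -/
theorem le_mul_sum_abs {d : ℕ} {N : EuclideanSpace ℝ (Fin d) → ℝ} {c : ℝ}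
    (hadd : ∀ u v, N (u + v) ≤ N u + N v) (hsmul : ∀ (ρ : ℝ) u, N (ρ • u) = |ρ| * N u)
    (hc : ∀ i, N (EuclideanSpace.single i 1) ≤ c) (x : EuclideanSpace ℝ (Fin d)) :
    N x ≤ c * ∑ i, |x i| := by
  have hN0 : N 0 = 0 := by simpa using hsmul 0 0
  have hx : x = ∑ i, x i • EuclideanSpace.single i (1 : ℝ) := by
    ext j
    simp [Pi.single_apply]
  calc N x = N (∑ i, x i • EuclideanSpace.single i (1 : ℝ)) := congrArg N hx
    _ ≤ ∑ i, N (x i • EuclideanSpace.single i (1 : ℝ)) :=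
        Finset.le_sum_of_subadditive N hN0.le hadd _ _
    _ ≤ ∑ i, c * |x i| := Finset.sum_le_sum fun i _ => by
        rw [hsmul, mul_comm c]
        exact mul_le_mul_of_nonneg_left (hc i) (abs_nonneg _)
    _ = c * ∑ i, |x i| := (Finset.mul_sum _ _ _).symm

theorem stmt16 (d : ℕ) (hd : 0 < d)
    (φ : ℕ → ℝ≥0∞) (hφ0 : φ 0 = 0) (hφpos : ∀ l, 1 ≤ l → l ≤ d → 0 < φ l)
    (hφfin : ∃ l, 1 ≤ l ∧ l ≤ d ∧ φ l ≠ ⊤)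
    (hφmono : ∀ k l, 1 ≤ k → k ≤ l → l ≤ d → φ k ≤ φ l) :
    φ 1 ≠ ⊤
    ∧ (∀ x : EuclideanSpace ℝ (Fin d), ∑ i, |x i| ≤ 1 →
        φ 1 * ENNReal.ofReal (∑ i, |x i|) ≤ φ (l0 x))
    ∧ (∀ N : EuclideanSpace ℝ (Fin d) → ℝ,
      (∀ u v, N (u + v) ≤ N u + N v) →
      (∀ (ρ : ℝ) u, N (ρ • u) = |ρ| * N u) →
      (∀ u, 0 ≤ N u) → (∀ u, N u = 0 ↔ u = 0) →
      (∀ x, ∑ i, |x i| ≤ 1 → ENNReal.ofReal (N x) ≤ φ (l0 x)) →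
      ∀ x, ENNReal.ofReal (N x) ≤ φ 1 * ENNReal.ofReal (∑ i, |x i|)) := by
  have hfin : φ 1 ≠ ⊤ := by
    obtain ⟨l, hl1, hld, hl⟩ := hφfin
    exact ne_top_of_le_ne_top hl (hφmono 1 l le_rfl hl1 hld)
  refine ⟨hfin, fun x hx => ?_, fun N hadd hsmul _ _ hle x => ?_⟩
  · rcases Nat.eq_zero_or_pos (l0 x) with h0 | hpos
    · simp [(l0_eq_zero_iff x).1 h0]
    · calc φ 1 * ENNReal.ofReal (∑ i, |x i|) ≤ φ 1 * 1 := by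
            gcongr
            exact ENNReal.ofReal_le_one.2 hx
        _ = φ 1 := mul_one _
        _ ≤ φ (l0 x) := hφmono 1 _ le_rfl hpos (l0_le x)
  · have hbasis (i : Fin d) : N (EuclideanSpace.single i 1) ≤ (φ 1).toReal := by
      have h := hle _ (sum_abs_single i).le
      rw [l0_single] at h
      exact (ENNReal.ofReal_le_iff_le_toReal hfin).1 h
    calc ENNReal.ofReal (N x) ≤ ENNReal.ofReal ((φ 1).toReal * ∑ i, |x i|) :=
          ENNReal.ofReal_le_ofReal (le_mul_sum_abs hadd hsmul hbasis x)
      _ = φ 1 * ENNReal.ofReal (∑ i, |x i|) := by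
          rw [ENNReal.ofReal_mul ENNReal.toReal_nonneg, ENNReal.ofReal_toReal hfin]
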